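/- arXiv:2101.05438 — 7 statements merged into one kernel-verified Lean document; each statement's English description precedes it below -/
import Mathlib

section
/- Let m ≥ 1 and let y_0, …, y_{m−1} be distinct positive real numbers. Then there exist real polynomials P_0, …, P_{2m−1} such that for each i, P_i has degree exactly i, P_i is an even polynomial when i is even and an odd polynomial when i is odd, and the 2m × 2m real matrix M defined by M[i,k] = P_i(x_k), where x_k = −y_k for 0 ≤ k ≤ m−1 and x_k = y_{k−m} for m ≤ k ≤ 2m−1, is an orthogonal matrix, i.e. M * Mᵀ = 1. -/
open Polynomial in
lemma aux_onb (S : Finset ℝ) (hS : ∀ x ∈ S, -x ∈ S) (n : ℕ) (hn : n ≤ S.card) :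
    ∃ P : ℕ → Polynomial ℝ, (∀ i < n, (P i).degree = (i : ℕ)) ∧
      (∀ i < n, ∀ x : ℝ, (P i).eval (-x) = (-1) ^ i * (P i).eval x) ∧
      (∀ i < n, ∀ j < n, ∑ x ∈ S, (P i).eval x * (P j).eval x = if i = j then 1 else 0) := by
  have hneg : ∀ f : ℝ → ℝ, ∑ x ∈ S, f (-x) = ∑ x ∈ S, f x := by
    intro f
    refine Finset.sum_nbij' (fun x => -x) (fun x => -x) hS hS ?_ ?_ ?_ <;> simp
  induction n with
  | zero => exact ⟨fun _ => 0, by simp, by simp, by simp⟩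
  | succ n ih =>
    obtain ⟨P, hd, hp, ho⟩ := ih (by omega)
    set c : ℕ → ℝ := fun i => ∑ x ∈ S, x ^ n * (P i).eval x with hc
    set R : Polynomial ℝ := ∑ i ∈ Finset.range n, C (c i) * P i with hR
    set Q : Polynomial ℝ := X ^ n - R with hQ
    have hRd : R.degree < n := by
      rw [hR]
      refine lt_of_le_of_lt (degree_sum_le _ _) ?_
      rw [Finset.sup_lt_iff (by exact WithBot.bot_lt_coe n)]
      intro i hi
      have hi' := Finset.mem_range.1 hi
      calc (C (c i) * P i).degree ≤ (C (c i)).degree + (P i).degree := degree_mul_le _ _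
        _ ≤ 0 + (P i).degree := by gcongr; exact degree_C_le
        _ = (i : ℕ) := by rw [zero_add, hd i hi']
        _ < n := by exact_mod_cast hi'
    have hQd : Q.degree = n := by
      rw [hQ, degree_sub_eq_left_of_degree_lt, degree_X_pow]
      rw [degree_X_pow]; exact hRd
    have hcp : ∀ i < n, c i = (-1) ^ n * (-1) ^ i * c i := by
      intro i hi
      have h := hneg (fun x => x ^ n * (P i).eval x)
      simp only [hc]
      rw [Finset.mul_sum, ← h]
      refine Finset.sum_congr rfl fun x _ => ?_
      rw [neg_pow, hp i hi]
      ring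
    have hQp : ∀ x : ℝ, Q.eval (-x) = (-1) ^ n * Q.eval x := by
      intro x
      simp only [hQ, hR, eval_sub, eval_pow, eval_X, eval_finsetSum, eval_mul, eval_C]
      rw [mul_sub, neg_pow, Finset.mul_sum]
      congr 1
      refine Finset.sum_congr rfl fun i hi => ?_
      have hi' := Finset.mem_range.1 hi
      rw [hp i hi']
      have h2 : ((-1 : ℝ) ^ i) * (-1) ^ i = 1 := by rw [← mul_pow]; simp
      linear_combination ((-1) ^ i * (P i).eval x) * hcp i hi' + (-1) ^ n * c i * eval x (P i) * h2
    have hQo : ∀ j < n, ∑ x ∈ S, Q.eval x * (P j).eval x = 0 := by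
      intro j hj
      simp only [hQ, hR, eval_sub, eval_pow, eval_X, eval_finsetSum, eval_mul, eval_C,
        sub_mul, Finset.sum_sub_distrib, Finset.sum_mul]
      rw [Finset.sum_comm]
      have : ∀ i ∈ Finset.range n, ∑ x ∈ S, c i * (P i).eval x * (P j).eval x
          = if i = j then c i else 0 := by
        intro i hi
        simp only [mul_assoc]
        rw [← Finset.mul_sum, ho i (Finset.mem_range.1 hi) j hj]
        simp
      rw [Finset.sum_congr rfl this]
      simp [hj, hc]
    have hQ0 : Q ≠ 0 := by
      intro h; rw [h] at hQd; simp at hQd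
    have hpos : 0 < ∑ x ∈ S, Q.eval x * Q.eval x := by
      refine Finset.sum_pos' (fun x _ => mul_self_nonneg _) ?_
      by_contra! hcon
      refine hQ0 (eq_zero_of_degree_lt_of_eval_finset_eq_zero S ?_ ?_)
      · rw [hQd]; exact_mod_cast hn
      · intro x hx
        exact mul_self_eq_zero.1 (le_antisymm (hcon x hx) (mul_self_nonneg _))
    set s := ∑ x ∈ S, Q.eval x * Q.eval x with hs
    have hsq : (√s)⁻¹ * (√s)⁻¹ * s = 1 := by
      rw [← mul_inv, Real.mul_self_sqrt hpos.le, inv_mul_cancel₀ hpos.ne']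
    have hne : (√s)⁻¹ ≠ 0 := inv_ne_zero (Real.sqrt_pos.2 hpos).ne'
    have hnew : ∀ j < n, ∑ x ∈ S, (C (√s)⁻¹ * Q).eval x * (P j).eval x = 0 := by
      intro j hj
      simp only [eval_mul, eval_C, mul_assoc]
      rw [← Finset.mul_sum, hQo j hj, mul_zero]
    refine ⟨fun i => if i = n then C (√s)⁻¹ * Q else P i, ?_, ?_, ?_⟩
    · intro i hi
      by_cases h : i = n
      · simp only [h, if_true]
        rw [degree_C_mul hne, hQd]
      · simp only [h, if_false]
        exact hd i (by omega)
    · intro i hi x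
      by_cases h : i = n
      · simp only [h, if_true, eval_mul, eval_C, hQp]
        ring
      · simp only [h, if_false]
        exact hp i (by omega) x
    · intro i hi j hj
      by_cases h : i = n
      · by_cases h' : j = n
        · simp only [h, h', if_true, eval_mul, eval_C]
          rw [← hsq, hs, Finset.mul_sum]
          exact Finset.sum_congr rfl fun x _ => by ring
        · have : n ≠ j := fun e => h' e.symm
          simp only [h, h', this, if_true, if_false]
          exact hnew j (by omega)
      · by_cases h' : j = n
        · subst h'
          simp only [h, if_true, if_false]
          rw [← hnew i (by omega)]
          exact Finset.sum_congr rfl fun x _ => by ring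
        · simp only [h, h', if_false]
          exact ho i (by omega) j (by omega)

/-- For `m ≥ 1` and distinct positive reals `y_0, …, y_{m-1}`, there exist real polynomials
`P_0, …, P_{2m-1}` with `P_i` of degree exactly `i`, even for even `i` and odd for odd `i`,
such that the `2m × 2m` matrix `M[i,k] = P_i(x_k)` (with `x_k = -y_k` for `k < m` and
`x_k = y_{k-m}` for `k ≥ m`) satisfies `M * Mᵀ = 1`. -/
theorem stmt_0 (m : ℕ) (hm : 1 ≤ m) (y : Fin m → ℝ)
    (hpos : ∀ k, 0 < y k) (hinj : Function.Injective y) :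
    ∃ P : Fin (2 * m) → Polynomial ℝ,
      (∀ i : Fin (2 * m), (P i).degree = (i : ℕ)) ∧
      (∀ i : Fin (2 * m), Even (i : ℕ) → ∀ x : ℝ, (P i).eval (-x) = (P i).eval x) ∧
      (∀ i : Fin (2 * m), Odd (i : ℕ) → ∀ x : ℝ, (P i).eval (-x) = -(P i).eval x) ∧
      ∀ M : Matrix (Fin (2 * m)) (Fin (2 * m)) ℝ,
        (∀ i k, M i k =
          (P i).eval (if h : (k : ℕ) < m then -y ⟨(k : ℕ), h⟩ else y ⟨(k : ℕ) - m, by omega⟩)) →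
        M * M.transpose = 1 := by
  set p : Fin (2 * m) → ℝ := fun k =>
    if h : (k : ℕ) < m then -y ⟨(k : ℕ), h⟩ else y ⟨(k : ℕ) - m, by omega⟩ with hp
  have hpi : Function.Injective p := by
    intro a b hab
    simp only [hp] at hab
    split_ifs at hab with h1 h2 h2
    · have := congrArg Fin.val (hinj (neg_injective hab))
      exact Fin.ext this
    · have h3 := hpos ⟨a, h1⟩
      have h4 := hpos ⟨(b : ℕ) - m, by omega⟩
      linarith
    · have h3 := hpos ⟨b, h2⟩
      have h4 := hpos ⟨(a : ℕ) - m, by omega⟩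
      linarith
    · have := congrArg Fin.val (hinj hab)
      simp only at this
      exact Fin.ext (by omega)
  have hcard : (Finset.univ.image p).card = 2 * m := by
    rw [Finset.card_image_of_injective _ hpi]; simp
  have hS : ∀ x ∈ Finset.univ.image p, -x ∈ Finset.univ.image p := by
    intro x hx
    obtain ⟨k, -, rfl⟩ := Finset.mem_image.1 hx
    refine Finset.mem_image.2 ?_
    by_cases h : (k : ℕ) < m
    · refine ⟨⟨k + m, by omega⟩, Finset.mem_univ _, ?_⟩
      simp [hp, h]
    · refine ⟨⟨k - m, by omega⟩, Finset.mem_univ _, ?_⟩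
      have h5 : (k : ℕ) - m < m := by omega
      simp only [hp, h, h5, dif_pos, dif_neg, not_false_eq_true]
  obtain ⟨P, hd, hpar, ho⟩ := aux_onb _ hS (2 * m) hcard.ge
  refine ⟨fun i => P i, fun i => hd i i.2, ?_, ?_, ?_⟩
  · intro i hi x
    rw [hpar i i.2, hi.neg_one_pow, one_mul]
  · intro i hi x
    rw [hpar i i.2, hi.neg_one_pow, neg_one_mul]
  · intro M hM
    ext i j
    have := ho i i.2 j j.2
    rw [Finset.sum_image (fun a _ b _ h => hpi h)] at this
    rw [Matrix.mul_apply, Matrix.one_apply]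
    simp only [Matrix.transpose_apply, hM]
    simp only [Fin.ext_iff]
    exact this
end

section
/- (Proposition 1.) Let m ≥ 2, let y_0, …, y_{m−1} be distinct positive real numbers, and let 1 ≤ t ≤ m−1. Let Q_0, …, Q_{t−1} be even real polynomials such that each Q_i has degree exactly 2i and the sequence is pairwise discretely orthogonal over the y_k (∑_{k=0}^{m−1} Q_i(y_k) Q_j(y_k) = 0 for i ≠ j). Then the t × t real matrix A_t with entries A_t[i, p] = ∑_{k=0}^{m−1} Q_i(y_k) · y_k^{2(t−p)}, for 0 ≤ i ≤ t−1 and 1 ≤ p ≤ t, has nonzero determinant. -/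
/-- Proposition 1: for `m ≥ 2`, distinct positive `y_k`, `1 ≤ t ≤ m-1`, and even polynomials
`Q_0, …, Q_{t-1}` with `Q_i` of degree exactly `2i`, pairwise discretely orthogonal over the
`y_k`, the matrix `A_t[i,p] = ∑_k Q_i(y_k) y_k^{2(t-p)}` (for `0 ≤ i ≤ t-1`, `1 ≤ p ≤ t`)
has nonzero determinant. -/
theorem stmt_3 (m : ℕ) (hm : 2 ≤ m) (y : Fin m → ℝ)
    (hpos : ∀ k, 0 < y k) (hinj : Function.Injective y)
    (t : ℕ) (ht1 : 1 ≤ t) (ht2 : t ≤ m - 1)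
    (Q : Fin t → Polynomial ℝ)
    (heven : ∀ i, ∀ x : ℝ, (Q i).eval (-x) = (Q i).eval x)
    (hdeg : ∀ i : Fin t, (Q i).degree = (2 * (i : ℕ) : ℕ))
    (horth : ∀ i j, i ≠ j → ∑ k, (Q i).eval (y k) * (Q j).eval (y k) = 0) :
    (Matrix.of fun i p : Fin t =>
      ∑ k, (Q i).eval (y k) * y k ^ (2 * (t - ((p : ℕ) + 1)))).det ≠ 0 := by
  intro hdet
  obtain ⟨v, hv, hvA⟩ := Matrix.exists_vecMul_eq_zero_iff.mpr hdet
  obtain ⟨P, hP⟩ : ∃ P : Polynomial ℝ, P = ∑ i, Polynomial.C (v i) * Q i := ⟨_, rfl⟩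
  have hPe : ∀ x, P.eval x = ∑ i, v i * (Q i).eval x := by
    intro x
    simp [hP, Polynomial.eval_finsetSum]
  have hPeven : ∀ x, P.eval (-x) = P.eval x := by
    intro x
    simp [hPe, heven]
  have hPdeg : P.natDegree < 2 * t := by
    have h : P.natDegree ≤ 2 * (t - 1) := by
      rw [hP]
      refine Polynomial.natDegree_sum_le_of_forall_le _ _ fun i _ => ?_
      refine (Polynomial.natDegree_C_mul_le _ _).trans ?_
      rw [Polynomial.natDegree_eq_of_degree_eq_some (hdeg i)]
      have := i.2
      omega
    omega
  have hcomp : P.comp (Polynomial.C (-1) * Polynomial.X) = P := by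
    apply Polynomial.funext
    intro x
    simp [Polynomial.eval_comp, hPeven]
  have hodd : ∀ n, Odd n → P.coeff n = 0 := by
    intro n hn
    have h := congrArg (fun p => Polynomial.coeff p n) hcomp
    simp only [Polynomial.comp_C_mul_X_coeff, hn.neg_one_pow] at h
    linarith
  have hmom : ∀ j, j < t → ∑ k, P.eval (y k) * y k ^ (2 * j) = 0 := by
    intro j hj
    have h := congrFun hvA ⟨t - 1 - j, by omega⟩
    simp only [Matrix.vecMul, dotProduct, Matrix.of_apply, Pi.zero_apply] at h
    rw [← h]
    have e : t - (t - 1 - j + 1) = j := by omega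
    simp only [e, hPe, Finset.sum_mul, Finset.mul_sum]
    rw [Finset.sum_comm]
    simp only [mul_assoc]
  have hsq : ∑ k, P.eval (y k) * P.eval (y k) = 0 := by
    have h1 : ∀ k, P.eval (y k) * P.eval (y k)
        = ∑ n ∈ Finset.range (2 * t), P.coeff n * (P.eval (y k) * y k ^ n) := by
      intro k
      have h := congrArg (fun z => P.eval (y k) * z) (Polynomial.eval_eq_sum_range' hPdeg (y k))
      simp only [Finset.mul_sum] at h
      rw [h]
      exact Finset.sum_congr rfl fun n _ => by ring
    simp only [h1]
    rw [Finset.sum_comm]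
    refine Finset.sum_eq_zero fun n hn => ?_
    rw [← Finset.mul_sum]
    rcases Nat.even_or_odd n with he | ho
    · obtain ⟨j, rfl⟩ := he.two_dvd
      rw [hmom j (by have := Finset.mem_range.mp hn; omega), mul_zero]
    · rw [hodd n ho, zero_mul]
  have hz : ∀ k, P.eval (y k) = 0 := by
    intro k
    have h := (Finset.sum_eq_zero_iff_of_nonneg
      (fun k _ => mul_self_nonneg (P.eval (y k)))).mp hsq k (Finset.mem_univ k)
    exact mul_self_eq_zero.mp h
  have hP0 : P = 0 := by
    refine Polynomial.eq_zero_of_natDegree_lt_card_of_eval_eq_zero P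
      (f := Sum.elim y (fun k => - y k)) ?_ ?_ ?_
    · refine hinj.sumElim (neg_injective.comp hinj) ?_
      intro a b h
      have := hpos a
      have := hpos b
      linarith
    · rintro (k | k)
      · exact hz k
      · simpa [hPeven] using hz k
    · simp only [Fintype.card_sum, Fintype.card_fin]
      omega
  have hsup := Polynomial.degree_sum_eq_of_disjoint
    (fun i => Polynomial.C (v i) * Q i) Finset.univ (by
      rintro i ⟨_, hi⟩ j ⟨_, hj⟩ hij
      have hi' : v i ≠ 0 := fun h => hi (by simp [h])
      have hj' : v j ≠ 0 := fun h => hj (by simp [h])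
      simp only [Function.onFun, Function.comp, Polynomial.degree_C_mul hi',
        Polynomial.degree_C_mul hj', hdeg]
      intro h
      have h2 : 2 * (i : ℕ) = 2 * (j : ℕ) := by exact_mod_cast h
      exact hij (Fin.ext (by omega)))
  rw [← hP, hP0, Polynomial.degree_zero] at hsup
  apply hv
  funext i
  by_contra hi
  have hle := Finset.le_sup (f := fun i => (Polynomial.C (v i) * Q i).degree) (Finset.mem_univ i)
  rw [← hsup] at hle
  simp only [Polynomial.degree_C_mul hi, hdeg] at hle
  exact absurd (le_bot_iff.mp hle) (WithBot.coe_ne_bot (a := 2 * (i : ℕ)))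
end

section
/- (Proposition 2.) Let m ≥ 2, let y_0, …, y_{m−1} be distinct positive real numbers, and let 1 ≤ t ≤ m−1. Let Q_0, …, Q_{t−1} be odd real polynomials such that each Q_i has degree exactly 2i+1 and the sequence is pairwise discretely orthogonal over the y_k (∑_{k=0}^{m−1} Q_i(y_k) Q_j(y_k) = 0 for i ≠ j). Then the t × t real matrix Â_t with entries Â_t[i, p] = ∑_{k=0}^{m−1} Q_i(y_k) · y_k^{2(t−p)+1}, for 0 ≤ i ≤ t−1 and 1 ≤ p ≤ t, has nonzero determinant. -/
/-- Proposition 2: for `m ≥ 2`, distinct positive `y_k`, `1 ≤ t ≤ m-1`, and odd polynomials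
`Q_0, …, Q_{t-1}` with `Q_i` of degree exactly `2i+1`, pairwise discretely orthogonal over the
`y_k`, the matrix `Â_t[i,p] = ∑_k Q_i(y_k) y_k^{2(t-p)+1}` (for `0 ≤ i ≤ t-1`, `1 ≤ p ≤ t`)
has nonzero determinant. -/
theorem stmt_4 (m : ℕ) (hm : 2 ≤ m) (y : Fin m → ℝ)
    (hpos : ∀ k, 0 < y k) (hinj : Function.Injective y)
    (t : ℕ) (ht1 : 1 ≤ t) (ht2 : t ≤ m - 1)
    (Q : Fin t → Polynomial ℝ)
    (hodd : ∀ i, ∀ x : ℝ, (Q i).eval (-x) = -(Q i).eval x)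
    (hdeg : ∀ i : Fin t, (Q i).degree = (2 * (i : ℕ) + 1 : ℕ))
    (horth : ∀ i j, i ≠ j → ∑ k, (Q i).eval (y k) * (Q j).eval (y k) = 0) :
    (Matrix.of fun i p : Fin t =>
      ∑ k, (Q i).eval (y k) * y k ^ (2 * (t - ((p : ℕ) + 1)) + 1)).det ≠ 0 := by
  intro hdet
  obtain ⟨v, hv0, hv⟩ := Matrix.exists_vecMul_eq_zero_iff.mpr hdet
  apply hv0
  set P : Polynomial ℝ := ∑ i, Polynomial.C (v i) * Q i with hP
  have hPe : ∀ x, P.eval x = ∑ i, v i * (Q i).eval x := by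
    intro x
    simp [hP, Polynomial.eval_finsetSum]
  have hPodd : ∀ x, P.eval (-x) = - P.eval x := by
    intro x
    simp [hPe, hodd]
  have hPdeg : P.degree < (2 * t : ℕ) := by
    refine (Polynomial.degree_sum_le _ _).trans_lt ?_
    rw [Finset.sup_lt_iff (WithBot.bot_lt_coe _)]
    intro i _
    by_cases hvi : v i = 0
    · rw [hvi, Polynomial.C_0, zero_mul, Polynomial.degree_zero]
      exact WithBot.bot_lt_coe (2 * t)
    rw [Polynomial.degree_C_mul hvi, hdeg]
    have := i.2
    exact_mod_cast (by omega : 2 * (i : ℕ) + 1 < 2 * t)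
  have hcomp : P.comp (Polynomial.C (-1) * Polynomial.X) = -P := by
    apply Polynomial.funext
    intro x
    simp [hPodd]
  have hcoef : ∀ n, Even n → P.coeff n = 0 := by
    intro n hn
    have h := congrArg (fun p => Polynomial.coeff p n) hcomp
    simp only [Polynomial.comp_C_mul_X_coeff, Polynomial.coeff_neg, hn.neg_one_pow] at h
    linarith
  -- orthogonality to odd powers
  have hpow : ∀ n, n < 2 * t → Odd n → ∑ k, P.eval (y k) * y k ^ n = 0 := by
    rintro n hn ⟨a, rfl⟩
    have h := congrFun hv ⟨t - 1 - a, by omega⟩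
    simp only [Matrix.vecMul, dotProduct, Matrix.of_apply, Pi.zero_apply] at h
    have e : 2 * (t - (t - 1 - a + 1)) + 1 = 2 * a + 1 := by omega
    rw [e] at h
    rw [← h]
    simp only [hPe, Finset.sum_mul, Finset.mul_sum]
    rw [Finset.sum_comm]
    simp only [mul_assoc]
  have hnd : P.natDegree < 2 * t := by
    rcases eq_or_ne P 0 with h0 | h0
    · rw [h0, Polynomial.natDegree_zero]
      omega
    · exact (Polynomial.natDegree_lt_iff_degree_lt h0).mpr hPdeg
  have hsq : ∑ k, P.eval (y k) * P.eval (y k) = 0 := by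
    have : ∀ k, P.eval (y k) * P.eval (y k)
        = ∑ n ∈ Finset.range (2 * t), P.coeff n * (P.eval (y k) * y k ^ n) := by
      intro k
      conv_lhs => rw [mul_comm]; arg 1; rw [Polynomial.eval_eq_sum_range' hnd]
      rw [Finset.sum_mul]
      exact Finset.sum_congr rfl fun n _ => by ring
    simp only [this]
    rw [Finset.sum_comm]
    refine Finset.sum_eq_zero fun n hn => ?_
    rw [← Finset.mul_sum]
    rcases Nat.even_or_odd n with h | h
    · rw [hcoef n h, zero_mul]
    · rw [hpow n (Finset.mem_range.mp hn) h, mul_zero]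
  have hroot : ∀ k, P.eval (y k) = 0 := by
    intro k
    have := (Finset.sum_eq_zero_iff_of_nonneg (fun k _ => mul_self_nonneg (P.eval (y k)))).mp hsq
      k (Finset.mem_univ k)
    exact mul_self_eq_zero.mp this
  have hP0 : P = 0 := by
    let f : Fin m ⊕ Fin m → ℝ := Sum.elim y (fun k => - y k)
    have hf : Function.Injective f := by
      refine hinj.sumElim (fun a b h => hinj (neg_injective h)) ?_
      intro a b h
      have h1 := hpos a
      have h2 := hpos b
      linarith
    refine Polynomial.eq_zero_of_natDegree_lt_card_of_eval_eq_zero P hf ?_ ?_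
    · rintro (k | k)
      · exact hroot k
      · simp [f, hPodd, hroot]
    · simp only [Fintype.card_sum, Fintype.card_fin]
      omega
  have hsup := Polynomial.degree_sum_eq_of_disjoint (fun i => Polynomial.C (v i) * Q i)
    Finset.univ (by
      rintro i ⟨_, hi⟩ j ⟨_, hj⟩ hij h
      have hi' : v i ≠ 0 := fun h => hi (by simp [h])
      have hj' : v j ≠ 0 := fun h => hj (by simp [h])
      simp only [Function.comp, Polynomial.degree_C_mul hi', Polynomial.degree_C_mul hj', hdeg] at h
      have h' : 2 * (i : ℕ) + 1 = 2 * (j : ℕ) + 1 := by exact_mod_cast h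
      exact hij (Fin.ext (by omega)))
  rw [← hP, hP0, Polynomial.degree_zero, eq_comm, Finset.sup_eq_bot_iff] at hsup
  funext i
  by_contra hvi
  have h := hsup i (Finset.mem_univ i)
  rw [Polynomial.degree_C_mul hvi, hdeg] at h
  exact WithBot.coe_ne_bot h
end

section
/- Let m ≥ 2, let y_0, …, y_{m−1} be distinct positive real numbers, and let 2 ≤ t ≤ m−1. Let Q_0, …, Q_{t−1} be even real polynomials such that Q_i has degree exactly 2i, Q_{t−1} has coefficient of X^{2(t−1)} equal to 1, and the sequence is pairwise discretely orthogonal over the y_k. Define the (t−1)×(t−1) matrix A_{t−1}[i,p] = ∑_{k=0}^{m−1} Q_i(y_k) y_k^{2(t−1−p)} (0 ≤ i ≤ t−2, 1 ≤ p ≤ t−1), the column vector B_{t−1}[i] = ∑_{k=0}^{m−1} Q_i(y_k) y_k^{2(t−1)} (0 ≤ i ≤ t−2), and for a real number x the t × t matrix C_t(x) whose first t−1 rows are the block [B_{t−1} | A_{t−1}] and whose bottom row is (x^{2(t−1)}, x^{2(t−2)}, …, x^2, 1). Then for every real x, det C_t(x) = (−1)^{t−1} · det A_{t−1} · Q_{t−1}(x).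 -/
lemma even_eval_aux (n : ℕ) (P : Polynomial ℝ) (he : ∀ x : ℝ, P.eval (-x) = P.eval x)
    (hd : P.degree = (2 * n : ℕ)) (x : ℝ) :
    P.eval x = ∑ j : Fin (n + 1), P.coeff (2 * (n - (j : ℕ))) * x ^ (2 * (n - (j : ℕ))) := by
  have hcomp : P.comp (Polynomial.C (-1) * Polynomial.X) = P := by
    apply Polynomial.funext
    intro r
    simp [he]
  have hodd : ∀ k, P.coeff (2 * k + 1) = 0 := by
    intro k
    have h := congrArg (fun p => Polynomial.coeff p (2 * k + 1)) hcomp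
    simp only [Polynomial.comp_C_mul_X_coeff] at h
    rw [Odd.neg_one_pow ⟨k, rfl⟩] at h
    linarith
  have hsplit : ∀ (f : ℕ → ℝ) (N : ℕ), ∑ i ∈ Finset.range (2 * N), f i =
      ∑ i ∈ Finset.range N, (f (2 * i) + f (2 * i + 1)) := by
    intro f N
    induction N with
    | zero => simp
    | succ N ih =>
      rw [show 2 * (N + 1) = 2 * N + 1 + 1 by ring, Finset.sum_range_succ,
        Finset.sum_range_succ, Finset.sum_range_succ, ih]
      ring
  have hnd : P.natDegree < 2 * (n + 1) := by
    rw [Polynomial.natDegree_eq_of_degree_eq_some hd]; omega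
  rw [Polynomial.eval_eq_sum_range' hnd, hsplit,
    Fin.sum_univ_eq_sum_range (fun j => P.coeff (2 * (n - j)) * x ^ (2 * (n - j))) (n + 1),
    ← Finset.sum_range_reflect]
  apply Finset.sum_congr rfl
  intro j _
  rw [hodd]
  simp

/-- For `2 ≤ t ≤ m-1`, even polynomials `Q_0, …, Q_{t-1}` of degrees `0, 2, …, 2(t-1)`,
`Q_{t-1}` monic in `X^{2(t-1)}`, pairwise discretely orthogonal over distinct positive
`y_0, …, y_{m-1}`: with `A_{t-1}[i,p] = ∑_k Q_i(y_k) y_k^{2(t-1-p)}`,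
`B_{t-1}[i] = ∑_k Q_i(y_k) y_k^{2(t-1)}`, and `C_t(x)` the `t × t` matrix whose first `t-1`
rows are `[B_{t-1} | A_{t-1}]` and whose bottom row is `(x^{2(t-1)}, …, x^2, 1)`, we have
`det C_t(x) = (-1)^{t-1} · det A_{t-1} · Q_{t-1}(x)` for every real `x`. -/
theorem stmt_11 (m : ℕ) (hm : 2 ≤ m) (y : Fin m → ℝ)
    (hpos : ∀ k, 0 < y k) (hinj : Function.Injective y)
    (t : ℕ) (ht1 : 2 ≤ t) (ht2 : t ≤ m - 1)
    (Q : Fin t → Polynomial ℝ)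
    (heven : ∀ i, ∀ x : ℝ, (Q i).eval (-x) = (Q i).eval x)
    (hdeg : ∀ i : Fin t, (Q i).degree = (2 * (i : ℕ) : ℕ))
    (hmonic : (Q ⟨t - 1, by omega⟩).coeff (2 * (t - 1)) = 1)
    (horth : ∀ i j, i ≠ j → ∑ k, (Q i).eval (y k) * (Q j).eval (y k) = 0)
    (A : Matrix (Fin (t - 1)) (Fin (t - 1)) ℝ)
    (hA : ∀ i p, A i p =
      ∑ k, (Q ⟨(i : ℕ), by omega⟩).eval (y k) * y k ^ (2 * (t - 1 - ((p : ℕ) + 1))))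
    (B : Fin (t - 1) → ℝ)
    (hB : ∀ i, B i = ∑ k, (Q ⟨(i : ℕ), by omega⟩).eval (y k) * y k ^ (2 * (t - 1)))
    (C : ℝ → Matrix (Fin t) (Fin t) ℝ)
    (hC : ∀ (x : ℝ) (i j : Fin t), C x i j =
      if hi : (i : ℕ) < t - 1 then
        (if (j : ℕ) = 0 then B ⟨(i : ℕ), hi⟩
         else A ⟨(i : ℕ), hi⟩ ⟨(j : ℕ) - 1, by omega⟩)
      else x ^ (2 * (t - 1 - (j : ℕ)))) :
    ∀ x : ℝ, (C x).det = (-1) ^ (t - 1) * A.det * (Q ⟨t - 1, by omega⟩).eval x := by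
  obtain ⟨n, rfl⟩ : ∃ n, t = n + 1 := ⟨t - 1, by omega⟩
  intro x
  change Matrix (Fin n) (Fin n) ℝ at A
  change Fin n → ℝ at B
  simp only [Nat.add_sub_cancel] at *
  change (Q (Fin.last n)).coeff (2 * n) = 1 at hmonic
  change _ = (-1) ^ n * A.det * (Q (Fin.last n)).eval x
  set P := Q (Fin.last n) with hP
  have hev : ∀ z : ℝ, P.eval z =
      ∑ j : Fin (n + 1), P.coeff (2 * (n - (j : ℕ))) * z ^ (2 * (n - (j : ℕ))) :=
    even_eval_aux n P (heven _) (by rw [hP, hdeg]; simp)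
  have hrow : ∀ (i : Fin n) (j : Fin (n + 1)), C x i.castSucc j =
      ∑ k, (Q i.castSucc).eval (y k) * y k ^ (2 * (n - (j : ℕ))) := by
    intro i j
    rw [hC]
    refine Fin.cases ?_ (fun p => ?_) j
    · simp [hB, Fin.castSucc, Fin.castAdd, Fin.castLE]
    · simp [hA, Fin.castSucc, Fin.castAdd, Fin.castLE]
  have hlast : ∀ j : Fin (n + 1), C x (Fin.last n) j = x ^ (2 * (n - (j : ℕ))) := by
    intro j
    rw [hC]
    simp
  have hdet := Matrix.det_updateCol_sum (C x) 0
    (fun j : Fin (n + 1) => P.coeff (2 * (n - (j : ℕ))))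
  simp only [Fin.val_zero, Nat.sub_zero, hmonic, one_smul] at hdet
  rw [← hdet, Matrix.det_succ_column_zero, Fin.sum_univ_castSucc]
  rw [Finset.sum_eq_zero]
  · simp only [Matrix.updateCol_self, hlast, smul_eq_mul, ← hev, Fin.val_last, zero_add]
    have : Matrix.submatrix ((C x).updateCol 0
        (fun k => ∑ i : Fin (n + 1), P.coeff (2 * (n - (i : ℕ))) * C x k i))
        (Fin.last n).succAbove Fin.succ = A := by
      ext i j
      simp only [Matrix.submatrix_apply, Fin.succAbove_last]
      rw [Matrix.updateCol_ne (Fin.succ_ne_zero j), hC]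
      simp
    rw [this]
    ring
  · intro i _
    have h0 : ∑ j : Fin (n + 1), P.coeff (2 * (n - (j : ℕ))) * C x i.castSucc j = 0 := by
      rw [← horth i.castSucc (Fin.last n) (Fin.castSucc_lt_last i).ne, ← hP]
      simp only [hrow, hev, Finset.mul_sum]
      rw [Finset.sum_comm]
      refine Finset.sum_congr rfl fun k _ => Finset.sum_congr rfl fun j _ => ?_
      ring
    simp only [Matrix.updateCol_self, smul_eq_mul, h0]
    simp
end

section
/- Let m ≥ 2, let y_0, …, y_{m−1} be distinct positive real numbers, and let 2 ≤ t ≤ m−1. Let Q_0, …, Q_{t−1} be even real polynomials such that Q_i has degree exactly 2i, Q_{t−1} has coefficient of X^{2(t−1)} equal to 1, and the sequence is pairwise discretely orthogonal over the y_k. For s ∈ {t−1, t}, define the s × s matrix A_s[i,p] = ∑_{k=0}^{m−1} Q_i(y_k) y_k^{2(s−p)} (0 ≤ i ≤ s−1, 1 ≤ p ≤ s). Then det A_t = (−1)^{t−1} · det A_{t−1} · ∑_{k=0}^{m−1} Q_{t−1}(y_k)². -/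
open Polynomial in
lemma even_coeff (P : Polynomial ℝ) (h : ∀ x : ℝ, P.eval (-x) = P.eval x) (i : ℕ) (hi : Odd i) :
    P.coeff i = 0 := by
  have h1 : P.comp (C (-1) * X) = P := by
    apply Polynomial.funext
    intro x
    simp [h]
  have h2 := congrArg (fun R => Polynomial.coeff R i) h1
  simp only [comp_C_mul_X_coeff] at h2
  rw [hi.neg_one_pow] at h2
  linarith

open Polynomial in
lemma orth_aux {m n : ℕ} (y : Fin m → ℝ) (Q : Fin (n + 1) → Polynomial ℝ)
    (hodd : ∀ i, ∀ j, Odd j → (Q i).coeff j = 0)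
    (hdeg : ∀ i : Fin (n + 1), (Q i).degree = (2 * (i : ℕ) : ℕ))
    (horth : ∀ i j, i ≠ j → ∑ k, (Q i).eval (y k) * (Q j).eval (y k) = 0)
    (l : ℕ) (hl : l ≤ n) (P : Polynomial ℝ) (hP : ∀ j, Odd j → P.coeff j = 0)
    (hPd : ∀ j, 2 * l ≤ j → P.coeff j = 0) :
    ∑ k, (Q (Fin.last n)).eval (y k) * P.eval (y k) = 0 := by
  induction l generalizing P with
  | zero =>
    have : P = 0 := by
      ext j
      simpa using hPd j (by omega)
    simp [this]
  | succ l ih =>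
    let a : Fin (n + 1) := ⟨l, by omega⟩
    have hnat : (Q a).natDegree = 2 * l := natDegree_eq_of_degree_eq_some (hdeg a)
    have hne : Q a ≠ 0 := by
      intro h0
      have := hdeg a
      rw [h0, degree_zero] at this
      exact WithBot.bot_ne_coe this
    have hc : (Q a).coeff (2 * l) ≠ 0 := by
      rw [← hnat]
      exact leadingCoeff_ne_zero.mpr hne
    have key := ih (by omega) (P - C (P.coeff (2 * l) / (Q a).coeff (2 * l)) * Q a)
      (by
        intro j hj
        simp [hP j hj, hodd a j hj])
      (by
        intro j hj
        rw [coeff_sub, coeff_C_mul]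
        rcases Nat.lt_trichotomy j (2 * l) with h | h | h
        · omega
        · subst h
          field_simp
          simp
        · rw [coeff_eq_zero_of_natDegree_lt (p := Q a) (n := j) (by omega)]
          rcases Nat.even_or_odd j with he | ho
          · obtain ⟨r, hr⟩ := he
            rw [hPd j (by omega)]
            simp
          · rw [hP j ho]
            simp)
    have ho := horth (Fin.last n) a (by
      intro h
      have := congrArg Fin.val h
      simp [a] at this
      omega)
    simp only [eval_sub, eval_mul, eval_C, mul_sub, Finset.sum_sub_distrib] at key
    rw [sub_eq_zero] at key
    rw [key]
    calc _ = (P.coeff (2 * l) / (Q a).coeff (2 * l)) *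
          ∑ k, (Q (Fin.last n)).eval (y k) * (Q a).eval (y k) := by
          rw [Finset.mul_sum]
          exact Finset.sum_congr rfl fun k _ => by ring
      _ = 0 := by rw [ho, mul_zero]

/-- For `2 ≤ t ≤ m-1`, even polynomials `Q_0, …, Q_{t-1}` of degrees `0, 2, …, 2(t-1)`,
`Q_{t-1}` monic in `X^{2(t-1)}`, pairwise discretely orthogonal over distinct positive
`y_0, …, y_{m-1}`: with `A_s[i,p] = ∑_k Q_i(y_k) y_k^{2(s-p)}` for `s ∈ {t-1, t}`, we have
`det A_t = (-1)^{t-1} · det A_{t-1} · ∑_k Q_{t-1}(y_k)²`. -/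
theorem stmt_12 (m : ℕ) (hm : 2 ≤ m) (y : Fin m → ℝ)
    (hpos : ∀ k, 0 < y k) (hinj : Function.Injective y)
    (t : ℕ) (ht1 : 2 ≤ t) (ht2 : t ≤ m - 1)
    (Q : Fin t → Polynomial ℝ)
    (heven : ∀ i, ∀ x : ℝ, (Q i).eval (-x) = (Q i).eval x)
    (hdeg : ∀ i : Fin t, (Q i).degree = (2 * (i : ℕ) : ℕ))
    (hmonic : (Q ⟨t - 1, by omega⟩).coeff (2 * (t - 1)) = 1)
    (horth : ∀ i j, i ≠ j → ∑ k, (Q i).eval (y k) * (Q j).eval (y k) = 0)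
    (At : Matrix (Fin t) (Fin t) ℝ)
    (hAt : ∀ i p, At i p = ∑ k, (Q i).eval (y k) * y k ^ (2 * (t - ((p : ℕ) + 1))))
    (At1 : Matrix (Fin (t - 1)) (Fin (t - 1)) ℝ)
    (hAt1 : ∀ i p, At1 i p =
      ∑ k, (Q ⟨(i : ℕ), by omega⟩).eval (y k) * y k ^ (2 * (t - 1 - ((p : ℕ) + 1)))) :
    At.det = (-1) ^ (t - 1) * At1.det * ∑ k, ((Q ⟨t - 1, by omega⟩).eval (y k)) ^ 2 := by
  obtain ⟨n, rfl⟩ : ∃ n, t = n + 1 := ⟨t - 1, by omega⟩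
  have hodd : ∀ i, ∀ j, Odd j → (Q i).coeff j = 0 := fun i j hj => even_coeff _ (heven i) j hj
  change (Q (Fin.last n)).coeff (2 * n) = 1 at hmonic
  change Matrix (Fin n) (Fin n) ℝ at At1
  change At.det = (-1) ^ n * At1.det * ∑ k, ((Q (Fin.last n)).eval (y k)) ^ 2
  have hnat : (Q (Fin.last n)).natDegree = 2 * n :=
    Polynomial.natDegree_eq_of_degree_eq_some (hdeg (Fin.last n))
  have h0 : At (Fin.last n) 0 = ∑ k, ((Q (Fin.last n)).eval (y k)) ^ 2 := by
    have := orth_aux y Q hodd hdeg horth n le_rfl (Polynomial.X ^ (2 * n) - Q (Fin.last n))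
      (by
        intro j hj
        rw [Polynomial.coeff_sub, hodd _ j hj, Polynomial.coeff_X_pow, if_neg, sub_zero]
        rintro rfl
        obtain ⟨r, hr⟩ := hj
        omega)
      (by
        intro j hj
        rw [Polynomial.coeff_sub, Polynomial.coeff_X_pow]
        rcases hj.eq_or_lt with h | h
        · subst h
          simp [hmonic]
        · rw [Polynomial.coeff_eq_zero_of_natDegree_lt (by omega), if_neg (by omega), sub_zero])
    simp only [Polynomial.eval_sub, Polynomial.eval_pow, Polynomial.eval_X, mul_sub,
      Finset.sum_sub_distrib] at this
    rw [sub_eq_zero] at this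
    rw [hAt]
    simp only [pow_two ((Q (Fin.last n)).eval _)]
    rw [← this]
    simp
  have hs : ∀ j : Fin n, At (Fin.last n) j.succ = 0 := by
    intro j
    have := orth_aux y Q hodd hdeg horth n le_rfl
      (Polynomial.X ^ (2 * (n + 1 - ((j.succ : ℕ) + 1))))
      (by
        intro i hi
        rw [Polynomial.coeff_X_pow, if_neg]
        rintro rfl
        obtain ⟨r, hr⟩ := hi
        omega)
      (by
        intro i hi
        rw [Polynomial.coeff_X_pow, if_neg]
        rw [Fin.val_succ]
        have := j.isLt
        omega)
    rw [hAt]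
    simpa using this
  have hsub : At.submatrix (Fin.last n).succAbove (Fin.succAbove 0) = At1 := by
    ext i p
    rw [Matrix.submatrix_apply, hAt, hAt1]
    refine Finset.sum_congr rfl fun k _ => ?_
    have e1 : (Fin.last n).succAbove i = ⟨(i : ℕ), by omega⟩ := by
      rw [Fin.succAbove_last]; rfl
    have e2 : n + 1 - (((Fin.succAbove 0 p : Fin (n + 1)) : ℕ) + 1)
        = n + 1 - 1 - ((p : ℕ) + 1) := by
      rw [Fin.succAbove_zero, Fin.val_succ]; omega
    rw [e1, e2]
  rw [Matrix.det_succ_row At (Fin.last n), Fin.sum_univ_succ]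
  simp only [hs, h0, hsub]
  simp
  ring
end

section
/- Let m ≥ 1, let y_0, …, y_{m−1} be distinct positive real numbers, and let 1 ≤ t ≤ m. Let Q_0, …, Q_{t−1} be even real polynomials with Q_i of degree exactly 2i, and let R be an even real polynomial of degree at most 2(t−1) such that ∑_{k=0}^{m−1} Q_i(y_k) R(y_k) = 0 for every 0 ≤ i ≤ t−1. Then R = 0. -/
open Polynomial in
theorem even_coeff_odd (P : Polynomial ℝ) (h : ∀ x : ℝ, P.eval (-x) = P.eval x) (n : ℕ) :
    P.coeff (2 * n + 1) = 0 := by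
  have h1 : P.comp (C (-1) * X) = P := by
    apply Polynomial.funext
    intro x
    simp [h]
  have h2 := congrArg (fun p => Polynomial.coeff p (2 * n + 1)) h1
  simp only [Polynomial.comp_C_mul_X_coeff] at h2
  have h3 : (-1 : ℝ) ^ (2 * n + 1) = -1 := by
    rw [pow_succ, pow_mul]; norm_num
  rw [h3] at h2
  linarith

/-- For `1 ≤ t ≤ m`, distinct positive `y_k`, even polynomials `Q_0, …, Q_{t-1}` with `Q_i` of
degree exactly `2i`, and an even polynomial `R` of degree at most `2(t-1)` satisfying
`∑_k Q_i(y_k) R(y_k) = 0` for all `i`, we must have `R = 0`. -/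
theorem stmt_13 (m : ℕ) (hm : 1 ≤ m) (y : Fin m → ℝ)
    (hpos : ∀ k, 0 < y k) (hinj : Function.Injective y)
    (t : ℕ) (ht1 : 1 ≤ t) (ht2 : t ≤ m)
    (Q : Fin t → Polynomial ℝ)
    (heven : ∀ i, ∀ x : ℝ, (Q i).eval (-x) = (Q i).eval x)
    (hdeg : ∀ i : Fin t, (Q i).degree = (2 * (i : ℕ) : ℕ))
    (R : Polynomial ℝ)
    (hReven : ∀ x : ℝ, R.eval (-x) = R.eval x)
    (hRdeg : R.degree ≤ (2 * (t - 1) : ℕ))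
    (horth : ∀ i, ∑ k, (Q i).eval (y k) * R.eval (y k) = 0) :
    R = 0 := by
  have key : ∀ n : ℕ, n ≤ t → ∀ P : Polynomial ℝ, (∀ x : ℝ, P.eval (-x) = P.eval x) →
      P.degree < (2 * n : ℕ) → ∑ k, P.eval (y k) * R.eval (y k) = 0 := by
    intro n
    induction n with
    | zero =>
      intro _ P _ hP
      have : P = 0 := by
        rw [Polynomial.degree_lt_iff_coeff_zero] at hP
        ext j
        simpa using hP j (by simp)
      simp [this]
    | succ n ih =>
      intro hn P hPe hP
      have hq := hdeg ⟨n, hn⟩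
      have hqe := heven ⟨n, hn⟩
      have hqo := horth ⟨n, hn⟩
      generalize Q ⟨n, hn⟩ = q at hq hqe hqo
      simp only at hq
      have hlc : q.coeff (2 * n) ≠ 0 := Polynomial.coeff_ne_zero_of_eq_degree hq
      set c := P.coeff (2 * n) / q.coeff (2 * n) with hc
      have h1 := ih (by omega) (P - Polynomial.C c * q) (by intro x; simp [hPe, hqe]) (by
        rw [Polynomial.degree_lt_iff_coeff_zero] at hP ⊢
        intro j hj
        rw [Polynomial.coeff_sub, Polynomial.coeff_C_mul]
        rcases Nat.eq_or_lt_of_le hj with h | h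
        · subst h
          rw [hc]
          field_simp
          ring
        · have hqj : q.coeff j = 0 := by
            apply Polynomial.coeff_eq_zero_of_degree_lt
            rw [hq]
            exact_mod_cast h
          have hPj : P.coeff j = 0 := by
            rcases Nat.eq_or_lt_of_le (Nat.succ_le_of_lt h) with h' | h'
            · rw [← h']
              exact even_coeff_odd P hPe n
            · exact hP j (by omega)
          rw [hqj, hPj]
          ring)
      have h2 : ∑ k, P.eval (y k) * R.eval (y k) =
          ∑ k, (P - Polynomial.C c * q).eval (y k) * R.eval (y k)
            + c * ∑ k, q.eval (y k) * R.eval (y k) := by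
        rw [Finset.mul_sum, ← Finset.sum_add_distrib]
        apply Finset.sum_congr rfl
        intro k _
        simp
        ring
      rw [h2, h1, hqo]
      ring
  have hRR := key t le_rfl R hReven (lt_of_le_of_lt hRdeg (by
    exact_mod_cast (by omega : 2 * (t - 1) < 2 * t)))
  rw [Finset.sum_eq_zero_iff_of_nonneg (fun k _ => mul_self_nonneg _)] at hRR
  have hz : ∀ k, R.eval (y k) = 0 := fun k => mul_self_eq_zero.mp (hRR k (Finset.mem_univ k))
  refine Polynomial.eq_zero_of_natDegree_lt_card_of_eval_eq_zero R
    (f := (Sum.elim y (fun k => - y k) : Fin m ⊕ Fin m → ℝ)) ?_ ?_ ?_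
  · rintro (a | a) (b | b) h
    · simp only [Sum.elim_inl] at h
      rw [hinj h]
    · simp only [Sum.elim_inl, Sum.elim_inr] at h
      linarith [hpos a, hpos b]
    · simp only [Sum.elim_inl, Sum.elim_inr] at h
      linarith [hpos a, hpos b]
    · simp only [Sum.elim_inr, neg_inj] at h
      rw [hinj h]
  · rintro (a | a)
    · simpa using hz a
    · simpa [hReven] using hz a
  · have := Polynomial.natDegree_le_of_degree_le hRdeg
    simp only [Fintype.card_sum, Fintype.card_fin]
    omega
end

section
/- For every integer n ≥ 1, the n × n real matrix C defined by C[0, k] = 1/√n for all 0 ≤ k ≤ n−1, and C[i, k] = √(2/n) · cos( i·(2k+1)·π / (2n) ) for 1 ≤ i ≤ n−1 and 0 ≤ k ≤ n−1, is an orthogonal matrix, i.e. C * Cᵀ = 1. (This is the Discrete Cosine Transform (DCT-II) matrix.) -/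
lemma dct_tele (θ : ℝ) (n : ℕ) :
    2 * Real.sin θ * ∑ k ∈ Finset.range n, Real.cos ((2 * (k : ℝ) + 1) * θ)
      = Real.sin (2 * n * θ) := by
  induction n with
  | zero => simp
  | succ n ih =>
    rw [Finset.sum_range_succ, mul_add, ih]
    have h1 : 2 * (n : ℝ) * θ = (2 * (n : ℝ) + 1) * θ - θ := by ring
    have h2 : 2 * ((n + 1 : ℕ) : ℝ) * θ = (2 * (n : ℝ) + 1) * θ + θ := by push_cast; ring
    rw [h1, h2, Real.sin_sub, Real.sin_add]
    ring

lemma dct_zero (n : ℕ) (hn : 1 ≤ n) (m : ℤ) (h0 : m ≠ 0) (h1 : -(2 * n : ℤ) < m)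
    (h2 : m < 2 * n) :
    ∑ k : Fin n, Real.cos ((2 * ((k : ℕ) : ℝ) + 1) * (m * Real.pi / (2 * n))) = 0 := by
  have hn' : (0 : ℝ) < n := by exact_mod_cast hn
  rw [Fin.sum_univ_eq_sum_range
    (fun k : ℕ => Real.cos ((2 * (k : ℝ) + 1) * (m * Real.pi / (2 * n)))) n]
  have h := dct_tele (m * Real.pi / (2 * n)) n
  have e : 2 * (n : ℝ) * (m * Real.pi / (2 * n)) = m * Real.pi := by field_simp
  rw [e, Real.sin_int_mul_pi] at h
  have hs : Real.sin (m * Real.pi / (2 * n)) ≠ 0 := by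
    have h1' : -(2 * n : ℝ) < m := by exact_mod_cast h1
    have h2' : (m : ℝ) < 2 * n := by exact_mod_cast h2
    have hp := Real.pi_pos
    intro hs
    rw [Real.sin_eq_zero_iff_of_lt_of_lt] at hs
    · have : (m : ℝ) ≠ 0 := by exact_mod_cast h0
      have : m * Real.pi / (2 * n) ≠ 0 := by positivity
      exact this hs
    · rw [lt_div_iff₀ (by positivity)]; nlinarith
    · rw [div_lt_iff₀ (by positivity)]; nlinarith
  rcases mul_eq_zero.mp h with h | h
  · exact absurd h (by simpa using hs)
  · exact h

/-- The `n × n` DCT-II matrix, `C[0,k] = 1/√n` and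
`C[i,k] = √(2/n) · cos(i(2k+1)π/(2n))` for `i ≥ 1`, is orthogonal: `C * Cᵀ = 1`. -/
theorem stmt_14 (n : ℕ) (hn : 1 ≤ n)
    (C : Matrix (Fin n) (Fin n) ℝ)
    (hC : ∀ i k : Fin n, C i k =
      if (i : ℕ) = 0 then 1 / Real.sqrt n
      else Real.sqrt (2 / n) *
        Real.cos ((i : ℕ) * (2 * (k : ℕ) + 1) * Real.pi / (2 * n))) :
    C * C.transpose = 1 := by
  have hn' : (0 : ℝ) < n := by exact_mod_cast hn
  obtain ⟨a, ha⟩ : ∃ a : Fin n → ℝ, a = fun i : Fin n =>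
    if (i : ℕ) = 0 then 1 / Real.sqrt n else Real.sqrt (2 / n) := ⟨_, rfl⟩
  have hC' : ∀ i k : Fin n, C i k = a i *
      Real.cos ((i : ℕ) * (2 * (k : ℕ) + 1) * Real.pi / (2 * n)) := by
    intro i k
    rw [hC, ha]
    by_cases h : (i : ℕ) = 0 <;> simp [h]
  have key : ∀ i j : Fin n, (C * C.transpose) i j = a i * a j / 2 *
      (∑ k : Fin n, Real.cos ((2 * ((k : ℕ) : ℝ) + 1) *
          (((i : ℕ) + (j : ℕ) : ℤ) * Real.pi / (2 * n)))
        + ∑ k : Fin n, Real.cos ((2 * ((k : ℕ) : ℝ) + 1) *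
          (((i : ℕ) - (j : ℕ) : ℤ) * Real.pi / (2 * n)))) := by
    intro i j
    rw [Matrix.mul_apply, ← Finset.sum_add_distrib, Finset.mul_sum]
    refine Finset.sum_congr rfl fun k _ => ?_
    rw [Matrix.transpose_apply, hC', hC']
    have e1 : (2 * ((k : ℕ) : ℝ) + 1) * ((((i : ℕ) + (j : ℕ) : ℤ) : ℝ) * Real.pi / (2 * n))
      = (i : ℕ) * (2 * (k : ℕ) + 1) * Real.pi / (2 * n)
        + (j : ℕ) * (2 * (k : ℕ) + 1) * Real.pi / (2 * n) := by push_cast; ring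
    have e2 : (2 * ((k : ℕ) : ℝ) + 1) * ((((i : ℕ) - (j : ℕ) : ℤ) : ℝ) * Real.pi / (2 * n))
      = (i : ℕ) * (2 * (k : ℕ) + 1) * Real.pi / (2 * n)
        - (j : ℕ) * (2 * (k : ℕ) + 1) * Real.pi / (2 * n) := by push_cast; ring
    rw [e1, e2, Real.cos_add, Real.cos_sub]
    ring
  ext i j
  rw [key]
  have hi := i.isLt
  have hj := j.isLt
  by_cases hij : i = j
  · subst hij
    rw [Matrix.one_apply_eq]
    by_cases h : (i : ℕ) = 0
    · have hs : Real.sqrt n * Real.sqrt n = n := Real.mul_self_sqrt hn'.le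
      have hs0 : Real.sqrt n ≠ 0 := by positivity
      simp only [ha, h]
      simp
      field_simp
      nlinarith
    · rw [dct_zero n hn _ (by omega) (by omega) (by omega)]
      have hs : Real.sqrt (2 / n) * Real.sqrt (2 / n) = 2 / n :=
        Real.mul_self_sqrt (by positivity)
      have hai : a i = Real.sqrt (2 / n) := by rw [ha]; simp [h]
      rw [hai, hs]
      simp
      field_simp
  · have hne : (i : ℕ) ≠ j := fun h => hij (Fin.ext h)
    rw [Matrix.one_apply_ne hij, dct_zero n hn _ (by omega) (by omega) (by omega),
      dct_zero n hn _ (by omega) (by omega) (by omega)]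
    simp
end
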